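/- arXiv:2403.07780 — 3 statements merged into one kernel-verified Lean document; each statement's English description precedes it below -/
import Mathlib

section
/- Let a probability space carry random variables X: Ω → 𝒳, A: Ω → {0,1}, Y: Ω → {0,1}, Ỹ: Ω → {0,1} satisfying the randomized response mechanism with parameters θ_{11}, θ_{10}, θ_{01}, θ_{00} ∈ [1/2, 1], and suppose θ_{a1} + θ_{a0} > 1 for a ∈ {0,1}. Let T_1, T_0 ∈ ℝ satisfy (T_1 + 1)θ_{11} + (T_1 − 1)θ_{10} = T_1 and (T_0 − 1)θ_{01} + (T_0 + 1)θ_{00} = T_0. Then for every a ∈ {0,1} and every x ∈ 𝒳 with μ(X = x, A = a, Y = y) > 0 for both y ∈ {0,1}, one has μ(Ỹ = 1 | X = x, A = a) > 1/2 if and only if μ(Y = 1 | X = x, A = a) > (1 + (2a − 1)·T_a)/2. -/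
open MeasureTheory

/-- Conditional probability of an event `E` given an event `F`: μ(E ∩ F)/μ(F). -/
noncomputable def condProb {Ω : Type*} [MeasurableSpace Ω] (μ : Measure Ω) (E F : Set Ω) : ℝ :=
  (μ (E ∩ F)).toReal / (μ F).toReal

/-- Splitting a set along the value of a measurable Boolean function. -/
lemma measureReal_eq_add_of_bool {Ω : Type*} [MeasurableSpace Ω] (μ : Measure Ω)
    [IsFiniteMeasure μ] {Y : Ω → Bool} (hY : Measurable Y) (F : Set Ω) :
    (μ F).toReal = (μ (F ∩ {ω | Y ω = true})).toReal + (μ (F ∩ {ω | Y ω = false})).toReal := by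
  have hm : MeasurableSet {ω | Y ω = true} := hY (measurableSet_singleton true)
  have hdiff : F \ {ω | Y ω = true} = F ∩ {ω | Y ω = false} := by
    ext ω
    simp
  rw [← measure_inter_add_sdiff F hm, hdiff,
    ENNReal.toReal_add (measure_ne_top _ _) (measure_ne_top _ _)]

/-- A noisy mixture with flip parameters `u`, `v` exceeds `1/2` exactly when the clean
proportion exceeds the shifted threshold `(1 + t) / 2`. -/
lemma half_lt_mixture_iff {p q u v t : ℝ} (hp : 0 < p) (hq : 0 < q) (huv : 1 < u + v)
    (ht : t * (u + v - 1) = v - u) :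
    1 / 2 < (u * p + (1 - v) * q) / (p + q) ↔ (1 + t) / 2 < p / (p + q) := by
  have hpq : 0 < p + q := add_pos hp hq
  have hs : 0 < u + v - 1 := by linarith
  rw [lt_div_iff₀ hpq, lt_div_iff₀ hpq, ← mul_lt_mul_iff_right₀ hs (b := (1 + t) / 2 * (p + q))]
  have key : (u + v - 1) * ((1 + t) / 2 * (p + q)) = (v - 1 / 2) * (p + q) := by
    linear_combination (p + q) / 2 * ht
  rw [key]
  constructor <;> intro h <;> linarith

/-- Under the randomized response mechanism with parameters
θ_{ay} ∈ [1/2,1] with θ_{a1} + θ_{a0} > 1, and threshold-shift parameters T₁, T₀ satisfying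
(T₁+1)θ₁₁ + (T₁−1)θ₁₀ = T₁ and (T₀−1)θ₀₁ + (T₀+1)θ₀₀ = T₀, for every a ∈ {0,1} and x with
μ(X = x, A = a, Y = y) > 0 for both y:
μ(Ỹ = 1 | X = x, A = a) > 1/2 ↔ μ(Y = 1 | X = x, A = a) > (1 + (2a − 1)·T_a)/2.
Here `A`, `Y`, `Ỹ` take values in {0,1}, encoded as `Bool`, `θ a y = θ_{ay}`, and
`T a` is `T₁` for a = 1 and `T₀` for a = 0, with `2a − 1 = 1` for a = 1 and `−1` for a = 0. -/
theorem stmt_4 {Ω 𝒳 : Type*} [MeasurableSpace Ω] [MeasurableSpace 𝒳]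
    (μ : Measure Ω) [IsProbabilityMeasure μ]
    (X : Ω → 𝒳) (A Y Ytil : Ω → Bool)
    (hX : Measurable X) (hA : Measurable A) (hY : Measurable Y) (hYtil : Measurable Ytil)
    (θ : Bool → Bool → ℝ)
    (hθ : ∀ a y, θ a y ∈ Set.Icc (1/2 : ℝ) 1)
    (hθsum : ∀ a : Bool, θ a true + θ a false > 1)
    (hRR1 : ∀ (a : Bool) (x : 𝒳),
      0 < μ {ω | X ω = x ∧ A ω = a ∧ Y ω = true} →
      condProb μ {ω | Ytil ω = true} {ω | X ω = x ∧ A ω = a ∧ Y ω = true} = θ a true)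
    (hRR0 : ∀ (a : Bool) (x : 𝒳),
      0 < μ {ω | X ω = x ∧ A ω = a ∧ Y ω = false} →
      condProb μ {ω | Ytil ω = true} {ω | X ω = x ∧ A ω = a ∧ Y ω = false} = 1 - θ a false)
    (T1 T0 : ℝ)
    (hc1 : (T1 + 1) * θ true true + (T1 - 1) * θ true false = T1)
    (hc0 : (T0 - 1) * θ false true + (T0 + 1) * θ false false = T0) :
    ∀ (a : Bool) (x : 𝒳),
      0 < μ {ω | X ω = x ∧ A ω = a ∧ Y ω = true} →
      0 < μ {ω | X ω = x ∧ A ω = a ∧ Y ω = false} →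
      (condProb μ {ω | Ytil ω = true} {ω | X ω = x ∧ A ω = a} > 1/2 ↔
        condProb μ {ω | Y ω = true} {ω | X ω = x ∧ A ω = a} >
          (1 + (if a then (1 : ℝ) else -1) * (if a then T1 else T0)) / 2) := by
  intro a x h1 h0
  have e1 := hRR1 a x h1
  have e0 := hRR0 a x h0
  have p1 := ENNReal.toReal_pos h1.ne' (measure_ne_top μ _)
  have p0 := ENNReal.toReal_pos h0.ne' (measure_ne_top μ _)
  unfold condProb at e1 e0 ⊢
  rw [div_eq_iff p1.ne'] at e1
  rw [div_eq_iff p0.ne'] at e0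
  have hF (y : Bool) : {ω | X ω = x ∧ A ω = a} ∩ {ω | Y ω = y} =
      {ω | X ω = x ∧ A ω = a ∧ Y ω = y} := by
    ext ω
    simp [and_assoc]
  rw [measureReal_eq_add_of_bool μ hY ({ω | Ytil ω = true} ∩ _),
    measureReal_eq_add_of_bool μ hY {ω | X ω = x ∧ A ω = a},
    Set.inter_comm {ω | Y ω = true}, Set.inter_assoc, Set.inter_assoc, hF, hF, e1, e0]
  refine half_lt_mixture_iff p1 p0 (hθsum a) ?_
  cases a
  · simp only [Bool.false_eq_true, if_false]
    linear_combination -hc0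
  · simp only [if_true]
    linear_combination hc1
end

section
/- Let T_1, T_0 ∈ [0, 1] and let p_{11}, p_{10}, p_{01}, p_{00} ≥ 0. For every (θ_{11}, θ_{10}, θ_{01}, θ_{00}) ∈ [1/2, 1]^4 satisfying (T_1 + 1)θ_{11} + (T_1 − 1)θ_{10} = T_1 and (T_0 − 1)θ_{01} + (T_0 + 1)θ_{00} = T_0, one has p_{11}θ_{11} + p_{10}θ_{10} + p_{01}θ_{01} + p_{00}θ_{00} ≤ p_{11}/(1 + T_1) + p_{10} + p_{01} + p_{00}/(1 + T_0); that is, the objective p_{11}θ_{11} + p_{10}θ_{10} + p_{01}θ_{01} + p_{00}θ_{00} over this feasible set is maximized at (1/(1 + T_1), 1, 1, 1/(1 + T_0)). -/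
/-- If `(T + 1) θ + (T - 1) η = T` with `T ∈ [0, 1]` and `η ≤ 1`, then `θ ≤ 1 / (1 + T)`, and hence
`p θ ≤ p / (1 + T)` for every nonnegative weight `p`. -/
theorem mul_le_div_one_add_of_constraint {T p θ η : ℝ} (hT : T ∈ Set.Icc (0 : ℝ) 1) (hp : 0 ≤ p)
    (hη : η ≤ 1) (h : (T + 1) * θ + (T - 1) * η = T) : p * θ ≤ p / (1 + T) := by
  have hθ : θ * (1 + T) ≤ 1 := by
    linarith [mul_nonneg (sub_nonneg.2 hT.2) (sub_nonneg.2 hη)]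
  rw [le_div_iff₀ (by linarith [hT.1]), mul_assoc]
  exact mul_le_of_le_one_right hp hθ

/-- For T₁, T₀ ∈ [0,1] and nonnegative p's, over all θ's in [1/2,1]
satisfying the fairness constraints, the objective p₁₁θ₁₁ + p₁₀θ₁₀ + p₀₁θ₀₁ + p₀₀θ₀₀
is maximized at (1/(1+T₁), 1, 1, 1/(1+T₀)). -/
theorem stmt_7 (T1 T0 p11 p10 p01 p00 : ℝ)
    (hT1 : T1 ∈ Set.Icc (0 : ℝ) 1) (hT0 : T0 ∈ Set.Icc (0 : ℝ) 1)
    (hp11 : 0 ≤ p11) (hp10 : 0 ≤ p10) (hp01 : 0 ≤ p01) (hp00 : 0 ≤ p00) :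
    ∀ θ11 θ10 θ01 θ00 : ℝ,
      θ11 ∈ Set.Icc (1/2 : ℝ) 1 → θ10 ∈ Set.Icc (1/2 : ℝ) 1 →
      θ01 ∈ Set.Icc (1/2 : ℝ) 1 → θ00 ∈ Set.Icc (1/2 : ℝ) 1 →
      (T1 + 1) * θ11 + (T1 - 1) * θ10 = T1 →
      (T0 - 1) * θ01 + (T0 + 1) * θ00 = T0 →
      p11 * θ11 + p10 * θ10 + p01 * θ01 + p00 * θ00 ≤
        p11 / (1 + T1) + p10 + p01 + p00 / (1 + T0) := by
  intro θ11 θ10 θ01 θ00 _ h10 h01 _ h1 h0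
  have h11 := mul_le_div_one_add_of_constraint hT1 hp11 h10.2 h1
  have h00 := mul_le_div_one_add_of_constraint hT0 hp00 h01.2 ((add_comm _ _).trans h0)
  linarith [mul_le_of_le_one_right hp10 h10.2, mul_le_of_le_one_right hp01 h01.2]
end

section
/- Let T_1, T_0 ∈ [−1, 0] and let p_{11}, p_{10}, p_{01}, p_{00} ≥ 0. For every (θ_{11}, θ_{10}, θ_{01}, θ_{00}) ∈ [1/2, 1]^4 satisfying (T_1 + 1)θ_{11} + (T_1 − 1)θ_{10} = T_1 and (T_0 − 1)θ_{01} + (T_0 + 1)θ_{00} = T_0, one has p_{11}θ_{11} + p_{10}θ_{10} + p_{01}θ_{01} + p_{00}θ_{00} ≤ p_{11} + p_{10}/(1 − T_1) + p_{01}/(1 − T_0) + p_{00}; that is, the objective p_{11}θ_{11} + p_{10}θ_{10} + p_{01}θ_{01} + p_{00}θ_{00} over this feasible set is maximized at (1, 1/(1 − T_1), 1/(1 − T_0), 1). -/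
/-- Under the fairness constraint with shift `T ∈ [-1, 0]`, if one keeping probability `x` is at
most `1` then the other, `y`, is at most `(1 - T)⁻¹`. -/
theorem le_inv_one_sub_of_fairness {T x y : ℝ} (hT : T ∈ Set.Icc (-1 : ℝ) 0) (hx : x ≤ 1)
    (h : (T + 1) * x + (T - 1) * y = T) : y ≤ (1 - T)⁻¹ := by
  obtain ⟨hT₁, hT₂⟩ := hT
  rw [← one_div, le_div_iff₀ (by linarith)]
  linarith [mul_le_of_le_one_right (by linarith : 0 ≤ T + 1) hx]

/-- For T₁, T₀ ∈ [−1,0] and nonnegative p's, over all θ's in [1/2,1]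
satisfying the fairness constraints, the objective p₁₁θ₁₁ + p₁₀θ₁₀ + p₀₁θ₀₁ + p₀₀θ₀₀
is maximized at (1, 1/(1−T₁), 1/(1−T₀), 1). -/
theorem stmt_8 (T1 T0 p11 p10 p01 p00 : ℝ)
    (hT1 : T1 ∈ Set.Icc (-1 : ℝ) 0) (hT0 : T0 ∈ Set.Icc (-1 : ℝ) 0)
    (hp11 : 0 ≤ p11) (hp10 : 0 ≤ p10) (hp01 : 0 ≤ p01) (hp00 : 0 ≤ p00) :
    ∀ θ11 θ10 θ01 θ00 : ℝ,
      θ11 ∈ Set.Icc (1/2 : ℝ) 1 → θ10 ∈ Set.Icc (1/2 : ℝ) 1 →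
      θ01 ∈ Set.Icc (1/2 : ℝ) 1 → θ00 ∈ Set.Icc (1/2 : ℝ) 1 →
      (T1 + 1) * θ11 + (T1 - 1) * θ10 = T1 →
      (T0 - 1) * θ01 + (T0 + 1) * θ00 = T0 →
      p11 * θ11 + p10 * θ10 + p01 * θ01 + p00 * θ00 ≤
        p11 + p10 / (1 - T1) + p01 / (1 - T0) + p00 := by
  intro θ11 θ10 θ01 θ00 h11 h10 h01 h00 h1 h0
  have b10 := le_inv_one_sub_of_fairness hT1 h11.2 h1
  have b01 := le_inv_one_sub_of_fairness hT0 h00.2 ((add_comm _ _).trans h0)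
  simp only [div_eq_mul_inv]
  linarith [mul_le_of_le_one_right hp11 h11.2, mul_le_mul_of_nonneg_left b10 hp10,
    mul_le_mul_of_nonneg_left b01 hp01, mul_le_of_le_one_right hp00 h00.2]
end
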